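/- Lemma A.1. Let T be a multiplicative commutative group, α a type, and f : α → α → α → α → T a function such that for all a,b,c,d ∈ α: (P1) f(a,b,c,c) = 1; (P2) f(a,b,c,d) = f(c,d,a,b); (P3) f(a,b,c,d) = f(a,b,d,c)⁻¹. Then for every q₁,q₂,q₃,q₄ ∈ α and every permutation σ of {1,2,3,4}, the identity f(q₁,q₂,q₃,q₄)·f(q₁,q₄,q₂,q₃)·f(q₁,q₃,q₄,q₂) = 1 holds if and only if the identity f(q_{σ(1)},q_{σ(2)},q_{σ(3)},q_{σ(4)})·f(q_{σ(1)},q_{σ(4)},q_{σ(2)},q_{σ(3)})·f(q_{σ(1)},q_{σ(3)},q_{σ(4)},q_{σ(2)}) = 1 holds. -/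

import Mathlib

/-- The cyclic product `f q₀ q₁ q₂ q₃ * f q₀ q₃ q₁ q₂ * f q₀ q₂ q₃ q₁`, in which the first
argument is fixed and the other three are rotated. -/
def cyclicProd {T α : Type*} [Mul T] (f : α → α → α → α → T) (q : Fin 4 → α) : T :=
  f (q 0) (q 1) (q 2) (q 3) * f (q 0) (q 3) (q 1) (q 2) * f (q 0) (q 2) (q 3) (q 1)

section

variable {T α : Type*} [CommGroup T] {f : α → α → α → α → T}

theorem inv_swap_left_of_inv_swap_right
    (pair_symm : ∀ a b c d, f a b c d = f c d a b)
    (inv_swap : ∀ a b c d, f a b c d = (f a b d c)⁻¹) (a b c d : α) :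
    f a b c d = (f b a c d)⁻¹ := by
  rw [pair_symm, inv_swap, pair_symm]

theorem cyclicProd_comp_swap_succ
    (pair_symm : ∀ a b c d, f a b c d = f c d a b)
    (inv_swap : ∀ a b c d, f a b c d = (f a b d c)⁻¹) (q : Fin 4 → α) (i : Fin 3) :
    cyclicProd f (q ∘ Equiv.swap i.castSucc i.succ) = (cyclicProd f q)⁻¹ := by
  have inv_swap_left := inv_swap_left_of_inv_swap_right pair_symm inv_swap
  fin_cases i
  · change f (q 1) (q 0) (q 2) (q 3) * f (q 1) (q 3) (q 0) (q 2) * f (q 1) (q 2) (q 3) (q 0) = _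
    rw [inv_swap_left (q 1) (q 0), pair_symm (q 1) (q 3), inv_swap (q 0) (q 2) (q 1),
      pair_symm (q 1) (q 2), inv_swap_left (q 3) (q 0), cyclicProd]
    simp only [mul_inv]
    exact mul_right_comm _ _ _
  · change f (q 0) (q 2) (q 1) (q 3) * f (q 0) (q 3) (q 2) (q 1) * f (q 0) (q 1) (q 3) (q 2) = _
    rw [inv_swap _ _ (q 1) (q 3), inv_swap _ _ (q 2) (q 1), inv_swap _ _ (q 3) (q 2), cyclicProd]
    simp only [mul_inv]
    ac_rfl
  · change f (q 0) (q 1) (q 3) (q 2) * f (q 0) (q 2) (q 1) (q 3) * f (q 0) (q 3) (q 2) (q 1) = _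
    rw [inv_swap _ _ (q 3) (q 2), inv_swap _ _ (q 1) (q 3), inv_swap _ _ (q 2) (q 1), cyclicProd]
    simp only [mul_inv]
    exact mul_right_comm _ _ _

theorem cyclicProd_comp_perm_eq_one_iff
    (pair_symm : ∀ a b c d, f a b c d = f c d a b)
    (inv_swap : ∀ a b c d, f a b c d = (f a b d c)⁻¹) (q : Fin 4 → α) (σ : Equiv.Perm (Fin 4)) :
    cyclicProd f (q ∘ σ) = 1 ↔ cyclicProd f q = 1 := by
  have hσ : σ ∈ Submonoid.closure
      (Set.range fun i : Fin 3 ↦ Equiv.swap i.castSucc i.succ) := by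
    rw [Equiv.Perm.mclosure_swap_castSucc_succ]
    exact Submonoid.mem_top σ
  induction hσ using Submonoid.closure_induction generalizing q with
  | mem τ hτ =>
    obtain ⟨i, rfl⟩ := hτ
    rw [cyclicProd_comp_swap_succ pair_symm inv_swap, inv_eq_one]
  | one => rfl
  | mul τ ρ _ _ hτ hρ => exact (hρ (q ∘ τ)).trans (hτ q)

end

/-- **Lemma A.1.** If `f : α → α → α → α → T` (with `T` a multiplicative commutative group)
satisfies (P1) `f a b c c = 1`, (P2) `f a b c d = f c d a b` and (P3) `f a b c d = (f a b d c)⁻¹`,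
then for any `q₁,q₂,q₃,q₄` and any permutation `σ` of a four-element set, the relation
`f q₁ q₂ q₃ q₄ * f q₁ q₄ q₂ q₃ * f q₁ q₃ q₄ q₂ = 1` holds iff the corresponding relation for
the permuted entries holds.  (Indices are `0`-based: `q 0, …, q 3` are the paper's `q₁,…,q₄`.) -/
theorem lemmaA1 {T : Type*} [CommGroup T] {α : Type*} (f : α → α → α → α → T)
    (P1 : ∀ a b c : α, f a b c c = 1)
    (P2 : ∀ a b c d : α, f a b c d = f c d a b)
    (P3 : ∀ a b c d : α, f a b c d = (f a b d c)⁻¹)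
    (q : Fin 4 → α) (σ : Equiv.Perm (Fin 4)) :
    f (q 0) (q 1) (q 2) (q 3) * f (q 0) (q 3) (q 1) (q 2) * f (q 0) (q 2) (q 3) (q 1) = 1 ↔
      f (q (σ 0)) (q (σ 1)) (q (σ 2)) (q (σ 3)) *
        f (q (σ 0)) (q (σ 3)) (q (σ 1)) (q (σ 2)) *
        f (q (σ 0)) (q (σ 2)) (q (σ 3)) (q (σ 1)) = 1 := by
  exact (cyclicProd_comp_perm_eq_one_iff P2 P3 q σ).symm
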